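/- For each natural number n, the Church numeral n̲ = λx λf (f)ⁿx is, up to α-equivalence, the unique normal λ-term of type N[sⁿ(0)] in the AF2 type system. -/

import Mathlib

/- Untyped λ-calculus with de Bruijn indices, head reduction, Church numerals. -/

inductive Lam : Type
  | var : ℕ → Lam
  | app : Lam → Lam → Lam
  | lam : Lam → Lam
deriving DecidableEq, Repr

namespace Lam

/-- Shift free variables `≥ c` up by 1. -/
def lift (c : ℕ) : Lam → Lam
  | var n => if n < c then var n else var (n + 1)
  | app s t => app (s.lift c) (t.lift c)
  | lam t => lam (t.lift (c + 1))

/-- Push a substitution under a binder. -/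
def up (σ : ℕ → Lam) : ℕ → Lam
  | 0 => var 0
  | n + 1 => (σ n).lift 0

/-- Capture-avoiding simultaneous substitution. -/
def subst (σ : ℕ → Lam) : Lam → Lam
  | var n => σ n
  | app s t => app (s.subst σ) (t.subst σ)
  | lam t => lam (t.subst (up σ))

/-- `t.subst0 u` is `t[u/0]`, the β-contractum substitution. -/
def subst0 (t u : Lam) : Lam :=
  t.subst (fun n => match n with | 0 => u | n + 1 => var n)

/-- `m` occurs free in the term. -/
def FreeIn (m : ℕ) : Lam → Prop
  | var n => n = m
  | app s t => s.FreeIn m ∨ t.FreeIn m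
  | lam t => t.FreeIn (m + 1)

/-- A closed λ-term. -/
def Closed (t : Lam) : Prop := ∀ m, ¬ t.FreeIn m

end Lam

/-- One-step β-reduction (anywhere in the term). -/
inductive Beta : Lam → Lam → Prop
  | beta (t u) : Beta (.app (.lam t) u) (t.subst0 u)
  | appL {s s'} (t) : Beta s s' → Beta (.app s t) (.app s' t)
  | appR {t t'} (s) : Beta t t' → Beta (.app s t) (.app s t')
  | lam {t t'} : Beta t t' → Beta (.lam t) (.lam t')

/-- β-equivalence `≃β`. -/
def BetaEq : Lam → Lam → Prop := Relation.EqvGen Beta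

/-- A term in (β-)normal form. -/
def NormalForm (t : Lam) : Prop := ∀ u, ¬ Beta t u

/-- One step of head reduction: reduce the head redex. -/
inductive HStep : Lam → Lam → Prop
  | beta (t u) : HStep (.app (.lam t) u) (t.subst0 u)
  | lam {t t'} : HStep t t' → HStep (.lam t) (.lam t')
  | app {t t'} (u) : HStep t t' → (∀ s, t ≠ .lam s) → HStep (.app t u) (.app t' u)

/-- `HRedN k u v` : `u ≻ v` by a head reduction of length `h(u,v) = k`. -/
inductive HRedN : ℕ → Lam → Lam → Prop
  | refl (t) : HRedN 0 t t
  | step {k t u v} : HStep t u → HRedN k u v → HRedN (k + 1) t v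

/-- `u ≻ v` : `v` is obtained from `u` by head reduction. -/
def HRed (t u : Lam) : Prop := ∃ k, HRedN k t u

/-- Head normal form: no head redex. -/
def HeadNormal (t : Lam) : Prop := ∀ u, ¬ HStep t u

/-- Solvable: the head reduction terminates. -/
def Solvable (t : Lam) : Prop := ∃ v, HRed t v ∧ HeadNormal v

/-- `(t)u₁…uₙ` : iterated application. -/
def appList : Lam → List Lam → Lam
  | t, [] => t
  | t, u :: us => appList (t.app u) us

/-- `(f)ⁿ x` with `x = var 1`, `f = var 0`. -/
def churchBody : ℕ → Lam
  | 0 => .var 1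
  | n + 1 => .app (.var 0) (churchBody n)

/-- Church numeral `n̲ = λx λf (f)ⁿ x`. -/
def church (n : ℕ) : Lam := .lam (.lam (churchBody n))

/-- `0̲ = λx λf x`. -/
def czero : Lam := .lam (.lam (.var 1))

/-- `s̲ = λn λx λf (f)((n)x)f`. -/
def csucc : Lam := .lam (.lam (.lam (.app (.var 0) (.app (.app (.var 2) (.var 1)) (.var 0)))))

/-- `(s̲)ⁿ 0̲`. -/
def succIter : ℕ → Lam
  | 0 => czero
  | n + 1 => .app csucc (succIter n)

/-- `G = λx λy (x) λz (y)(s̲)z`. -/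
def Gop : Lam := .lam (.lam (.app (.var 1) (.lam (.app (.var 1) (.app csucc (.var 0))))))

/-- `δ = λf (f)0̲`. -/
def deltaOp : Lam := .lam (.app (.var 0) czero)

/-- `T₁ = λn ((n)δ)G`. -/
def T1 : Lam := .lam (.app (.app (.var 0) deltaOp) Gop)

/-- `F = λx λy (x)(s̲)y`. -/
def Fop : Lam := .lam (.lam (.app (.var 1) (.app csucc (.var 0))))

/-- `T₂ = λn λf (((n)f)F)0̲`. -/
def T2 : Lam := .lam (.lam (.app (.app (.app (.var 1) (.var 0)) Fop) czero))

/-- `θ₀ = λx λf λz (x)(λd z)(λx x)`. -/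
def theta0 : Lam := .lam (.lam (.lam (.app (.app (.var 2) (.lam (.var 1))) (.lam (.var 0)))))

/-- `T` is a storage operator for the integers (the fixed variable `f` is `var 0`). -/
def IsStorage (T : Lam) : Prop :=
  ∀ n : ℕ, ∃ τ : Lam, BetaEq τ (church n) ∧
    ∀ θ : Lam, BetaEq θ (church n) →
      ∃ σ : ℕ → Lam, HRed (.app (.app T θ) (.var 0)) (.app (.var 0) (τ.subst σ))

/- AF2 : second-order functional arithmetic over the language {0, s}.
   First-order variables are de Bruijn indices; predicate variables are named
   by a `Bool` (true = ⊥-variable of AF2⊥) and a number, each with an arity. -/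

inductive Tm : Type
  | var : ℕ → Tm
  | zero : Tm
  | succ : Tm → Tm
deriving DecidableEq

namespace Tm

def liftBy (c m : ℕ) : Tm → Tm
  | var n => if n < c then var n else var (n + m)
  | zero => zero
  | succ t => succ (t.liftBy c m)

def up (σ : ℕ → Tm) : ℕ → Tm
  | 0 => var 0
  | n + 1 => (σ n).liftBy 0 1

def subst (σ : ℕ → Tm) : Tm → Tm
  | var n => σ n
  | zero => zero
  | succ t => succ (t.subst σ)

end Tm

/-- The first-order term `sⁿ(0)`. -/
def snum : ℕ → Tm
  | 0 => .zero
  | n + 1 => .succ (snum n)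

/-- Second-order formulas.  `pvar b X args` is the atomic formula `X(args)`,
`b = true` marking the special ⊥-variables of AF2⊥; `all1` binds a first-order
de Bruijn variable; `all2 b X k A` is `∀X A` for the `k`-ary predicate variable `(b,X)`. -/
inductive Fml : Type
  | pvar (b : Bool) (X : ℕ) (args : List Tm)
  | arr (A B : Fml)
  | all1 (A : Fml)
  | all2 (b : Bool) (X : ℕ) (k : ℕ) (A : Fml)
deriving DecidableEq

/-- Absurdity `⊥ := ∀X X` (for a 0-ary predicate variable `X`). -/
def botF : Fml := .all2 false 0 0 (.pvar false 0 [])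

/-- `¬A := A → ⊥`. -/
def negF (A : Fml) : Fml := A.arr botF

namespace Fml

/-- Shift first-order variables `≥ c` by `m`. -/
def lift1By (c m : ℕ) : Fml → Fml
  | pvar b X args => pvar b X (args.map (Tm.liftBy c m))
  | arr A B => arr (A.lift1By c m) (B.lift1By c m)
  | all1 A => all1 (A.lift1By (c + 1) m)
  | all2 b X k A => all2 b X k (A.lift1By c m)

/-- First-order substitution in a formula. -/
def subst1 (σ : ℕ → Tm) : Fml → Fml
  | pvar b X args => pvar b X (args.map (Tm.subst σ))
  | arr A B => arr (A.subst1 σ) (B.subst1 σ)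
  | all1 A => all1 (A.subst1 (Tm.up σ))
  | all2 b X k A => all2 b X k (A.subst1 σ)

/-- `A[u/x]` for the first-order variable `0`. -/
def substTop (u : Tm) (A : Fml) : Fml :=
  A.subst1 (fun n => match n with | 0 => u | n + 1 => Tm.var n)

/-- The predicate variable `(b, X)` occurs free. -/
def fv2 (b : Bool) (X : ℕ) : Fml → Prop
  | pvar b' X' _ => b = b' ∧ X = X'
  | arr A B => A.fv2 b X ∨ B.fv2 b X
  | all1 A => A.fv2 b X
  | all2 b' X' _ A => ¬(b = b' ∧ X = X') ∧ A.fv2 b X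

/-- Instantiate the `k` argument slots (first-order variables `0,…,k-1`) of `G` by `args`. -/
def instArgs (k : ℕ) (G : Fml) (args : List Tm) : Fml :=
  G.subst1 (fun n => if n < k then args.getD n Tm.zero else Tm.var (n - k))

/-- `A[G/X]` : substitution of the formula `G` (with argument slots `0,…,k-1`)
for the `k`-ary predicate variable `(b, X)`; `d` is the number of first-order
binders already crossed. -/
def psubst (b : Bool) (X : ℕ) (k : ℕ) (G : Fml) : ℕ → Fml → Fml
  | d, pvar b' X' args =>
      if b = b' ∧ X = X' then instArgs k (G.lift1By k d) args else pvar b' X' args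
  | d, arr A B => arr (psubst b X k G d A) (psubst b X k G d B)
  | d, all1 A => all1 (psubst b X k G (d + 1) A)
  | d, all2 b' X' m A =>
      if b = b' ∧ X = X' then all2 b' X' m A else all2 b' X' m (psubst b X k G d A)

end Fml

/-- ⊥-types : formulas ending with `⊥` or with an atom `X_⊥(t̄)`. -/
inductive IsBotFml : Fml → Prop
  | bot : IsBotFml botF
  | pvar (X args) : IsBotFml (.pvar true X args)
  | arr (A) {B} : IsBotFml B → IsBotFml (.arr A B)
  | all1 {A} : IsBotFml A → IsBotFml (.all1 A)
  | all2 (b X k) {A} : IsBotFml A → IsBotFml (.all2 b X k A)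

/-- Equational consequence of a set `E` of equations. -/
inductive EqCns (E : Set (Tm × Tm)) : Tm → Tm → Prop
  | ax {u v : Tm} (σ : ℕ → Tm) : (u, v) ∈ E → EqCns E (u.subst σ) (v.subst σ)
  | refl (t) : EqCns E t t
  | symm {u v} : EqCns E u v → EqCns E v u
  | trans {u v w} : EqCns E u v → EqCns E v w → EqCns E u w
  | succ {u v} : EqCns E u v → EqCns E u.succ v.succ

/-- `E` is adequate with the type of integers. -/
def Adequate (E : Set (Tm × Tm)) : Prop :=
  (∀ a, ¬ EqCns E (Tm.succ a) Tm.zero) ∧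
  (∀ a b, EqCns E (Tm.succ a) (Tm.succ b) → EqCns E a b)

/-- The AF2 type system (Curry style, de Bruijn contexts, equational rule for `E`). -/
inductive DerA (E : Set (Tm × Tm)) : List Fml → Lam → Fml → Prop
  | var (Γ n A) : Γ[n]? = some A → DerA E Γ (.var n) A
  | lamI {Γ A t B} : DerA E (A :: Γ) t B → DerA E Γ (.lam t) (.arr A B)
  | appE {Γ u v A B} : DerA E Γ u (.arr A B) → DerA E Γ v A → DerA E Γ (.app u v) B
  | all1I {Γ t A} : DerA E (Γ.map (Fml.lift1By 0 1)) t A → DerA E Γ t (.all1 A)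
  | all1E {Γ t A} (u) : DerA E Γ t (.all1 A) → DerA E Γ t (A.substTop u)
  | all2I {Γ t A} (b X k) : DerA E Γ t A → (∀ B ∈ Γ, ¬ B.fv2 b X) →
      DerA E Γ t (.all2 b X k A)
  | all2E {Γ t b X k A} (G) : DerA E Γ t (.all2 b X k A) →
      DerA E Γ t (Fml.psubst b X k G 0 A)
  | eqr {Γ : List Fml} {t : Lam} {A : Fml} {u v : Tm} : DerA E Γ t (A.substTop u) → EqCns E u v →
      DerA E Γ t (A.substTop v)

/-- The AF2⊥ type system: as AF2, but a ⊥-variable may only be instantiated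
by a ⊥-type. -/
inductive DerB (E : Set (Tm × Tm)) : List Fml → Lam → Fml → Prop
  | var (Γ n A) : Γ[n]? = some A → DerB E Γ (.var n) A
  | lamI {Γ A t B} : DerB E (A :: Γ) t B → DerB E Γ (.lam t) (.arr A B)
  | appE {Γ u v A B} : DerB E Γ u (.arr A B) → DerB E Γ v A → DerB E Γ (.app u v) B
  | all1I {Γ t A} : DerB E (Γ.map (Fml.lift1By 0 1)) t A → DerB E Γ t (.all1 A)
  | all1E {Γ t A} (u) : DerB E Γ t (.all1 A) → DerB E Γ t (A.substTop u)
  | all2I {Γ t A} (b X k) : DerB E Γ t A → (∀ B ∈ Γ, ¬ B.fv2 b X) →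
      DerB E Γ t (.all2 b X k A)
  | all2E {Γ t b X k A} (G) : DerB E Γ t (.all2 b X k A) →
      (b = true → IsBotFml G) → DerB E Γ t (Fml.psubst b X k G 0 A)
  | eqr {Γ : List Fml} {t : Lam} {A : Fml} {u v : Tm} : DerB E Γ t (A.substTop u) → EqCns E u v →
      DerB E Γ t (A.substTop v)

/-- `N[t] = ∀X{X(0), ∀y(X(y)→X(sy)) → X(t)}`, with `b` choosing the kind of
the quantified (unary) predicate variable. -/
def NtyGen (b : Bool) (t : Tm) : Fml :=
  .all2 b 0 1 (.arr (.pvar b 0 [Tm.zero])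
    (.arr (.all1 (.arr (.pvar b 0 [Tm.var 0]) (.pvar b 0 [Tm.succ (Tm.var 0)])))
      (.pvar b 0 [t])))

/-- The type `N[t]` of integers. -/
def Nty (t : Tm) : Fml := NtyGen false t

/-- `N^⊥[t]`, quantifying over a ⊥-variable. -/
def Nbot (t : Tm) : Fml := NtyGen true t

/-- The simple Gödel translation `N*[t] = ∀X{¬X(0), ∀y(¬X(y)→¬X(sy)) → ¬X(t)}`. -/
def Nstar (t : Tm) : Fml :=
  .all2 false 0 1 (.arr (negF (.pvar false 0 [Tm.zero]))
    (.arr (.all1 (.arr (negF (.pvar false 0 [Tm.var 0]))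
        (negF (.pvar false 0 [Tm.succ (Tm.var 0)]))))
      (negF (.pvar false 0 [t]))))

/-- `∀x{N*[x] → ¬¬N[x]}`. -/
def specStar : Fml := .all1 ((Nstar (Tm.var 0)).arr (negF (negF (Nty (Tm.var 0)))))

/-- `∀x{N^⊥[x] → ¬¬N[x]}`. -/
def specBot : Fml := .all1 ((Nbot (Tm.var 0)).arr (negF (negF (Nty (Tm.var 0)))))

namespace Lam

theorem lift_subst (t : Lam) (c : ℕ) (τ : ℕ → Lam) :
    (t.lift c).subst τ = t.subst (fun n => τ (if n < c then n else n + 1)) := by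
  induction t generalizing c τ with
  | var n => simp only [lift]; split_ifs <;> simp [subst, *]
  | app s t ihs iht => simp [lift, subst, ihs, iht]
  | lam t ih =>
    simp only [lift, subst, ih]
    congr 2
    funext n
    cases n with
    | zero => simp [up]
    | succ n => by_cases h : n < c <;> simp [up, h]

theorem lift_lift (t : Lam) {c e : ℕ} (h : c ≤ e) :
    (t.lift c).lift (e + 1) = (t.lift e).lift c := by
  induction t generalizing c e with
  | var n => simp only [lift]; split_ifs <;> simp only [lift] <;> split_ifs <;> grind
  | app s t ihs iht => simp [lift, ihs h, iht h]
  | lam t ih => simp [lift, ih (Nat.succ_le_succ h)]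

theorem subst_lift (t : Lam) (c : ℕ) (σ : ℕ → Lam) :
    (t.subst σ).lift c = t.subst (fun n => (σ n).lift c) := by
  induction t generalizing c σ with
  | var n => rfl
  | app s t ihs iht => simp [lift, subst, ihs, iht]
  | lam t ih =>
    simp only [lift, subst, ih]
    congr 2
    funext n
    cases n with
    | zero => simp [up, lift]
    | succ n => simp [up, lift_lift]

theorem subst_subst (t : Lam) (σ τ : ℕ → Lam) :
    (t.subst σ).subst τ = t.subst (fun n => (σ n).subst τ) := by
  induction t generalizing σ τ with
  | var n => rfl
  | app s t ihs iht => simp [subst, ihs, iht]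
  | lam t ih =>
    simp only [subst, ih]
    congr 2
    funext n
    cases n with
    | zero => simp [up, subst]
    | succ n => simp [up, lift_subst, subst_lift]

theorem subst_var (t : Lam) : t.subst var = t := by
  induction t with
  | var n => rfl
  | app s t ihs iht => simp [subst, ihs, iht]
  | lam t ih =>
    have h : up var = var := by
      funext n
      cases n <;> simp [up, lift]
    simp [subst, h, ih]

/-- Extend a substitution by a value for the index `0`. -/
def scons (a : Lam) (σ : ℕ → Lam) : ℕ → Lam
  | 0 => a
  | n + 1 => σ n

theorem subst_up_subst0 (t a : Lam) (σ : ℕ → Lam) :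
    (t.subst (up σ)).subst0 a = t.subst (scons a σ) := by
  rw [subst0, subst_subst]
  congr 1
  funext n
  cases n with
  | zero => rfl
  | succ n =>
    simp only [up, lift_subst, scons]
    exact subst_var _

/-- A variable applied to arbitrarily many arguments. -/
def Neutral : Lam → Prop
  | var _ => True
  | app s _ => s.Neutral
  | lam _ => False

theorem Neutral.rename {t : Lam} (h : t.Neutral) (ξ : ℕ → ℕ) :
    (t.subst fun n => var (ξ n)).Neutral := by
  induction t with
  | var n => trivial
  | app s t ih _ => exact ih h
  | lam t => exact h.elim

end Lam

open Lam

/-- Weak head reduction. -/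
inductive WeakHead : Lam → Lam → Prop
  | beta (t u) : WeakHead (.app (.lam t) u) (t.subst0 u)
  | app {t t'} (u) : WeakHead t t' → WeakHead (.app t u) (.app t' u)

theorem WeakHead.toBeta {t t' : Lam} (h : WeakHead t t') : Beta t t' := by
  induction h with
  | beta t u => exact .beta t u
  | app u _ ih => exact .appL u ih

theorem Lam.Neutral.not_weakHead {t t' : Lam} (h : t.Neutral) : ¬ WeakHead t t' := by
  intro hw
  induction hw with
  | beta t u => exact h
  | app u _ ih => exact ih h

theorem NormalForm.appL {u v : Lam} (h : NormalForm (.app u v)) : NormalForm u :=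
  fun _ hw => h _ (.appL v hw)

theorem NormalForm.appR {u v : Lam} (h : NormalForm (.app u v)) : NormalForm v :=
  fun _ hw => h _ (.appR u hw)

theorem NormalForm.of_lam {t : Lam} (h : NormalForm (.lam t)) : NormalForm t :=
  fun _ hw => h _ (.lam hw)

theorem NormalForm.neutral_of_app {u v : Lam} (h : NormalForm (.app u v)) : u.Neutral := by
  induction u generalizing v with
  | var n => trivial
  | app s t ih _ => exact ih h.appL
  | lam t => exact h _ (.beta t v)

/-- The terms that evaluate, by iterated weak head reduction, to `churchBody n`. -/
inductive Evaluates : ℕ → Lam → Prop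
  | zero : Evaluates 0 (.var 1)
  | succ {n a} : Evaluates n a → Evaluates (n + 1) (.app (.var 0) a)
  | expand {n t t'} : WeakHead t t' → Evaluates n t' → Evaluates n t

theorem Evaluates.eq_churchBody {n : ℕ} {t : Lam} (h : Evaluates n t) (ht : NormalForm t) :
    t = churchBody n := by
  induction h with
  | zero => rfl
  | succ _ ih => rw [churchBody, ih ht.appR]
  | expand hw _ _ => exact (ht _ hw.toBeta).elim


theorem Evaluates.eq_var_zero_of_neutral {n : ℕ} {t u : Lam} (h : Evaluates n (.app t u))
    (ht : t.Neutral) : t = .var 0 := by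
  cases h with
  | succ _ => rfl
  | expand hw _ => exact (Neutral.not_weakHead (t := .app t u) ht hw).elim

theorem WeakHead.deterministic {t u v : Lam} (hu : WeakHead t u) (hv : WeakHead t v) : u = v := by
  induction hu generalizing v with
  | beta t u =>
    cases hv with
    | beta => rfl
    | app _ h => cases h
  | app u h ih =>
    cases hv with
    | beta => cases h
    | app _ h' => rw [ih h']

theorem Evaluates.of_weakHead {n : ℕ} {t t' : Lam} (h : Evaluates n t) (hw : WeakHead t t') :
    Evaluates n t' := by
  cases h with
  | zero => cases hw
  | succ _ => cases hw with | app _ hw => cases hw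
  | expand hw' h => exact hw.deterministic hw' ▸ h

theorem NormalForm.neutral_or_eq_lam {t : Lam} (h : NormalForm t) :
    t.Neutral ∨ ∃ u, t = .lam u := by
  cases t with
  | var n => exact .inl trivial
  | app u v => exact .inl h.neutral_of_app
  | lam u => exact .inr ⟨u, rfl⟩

theorem NormalForm.eq_church {n : ℕ} {t : Lam} (ht : NormalForm t)
    (h : Evaluates n (.app (.app (t.subst fun n => .var (n + 2)) (.var 1)) (.var 0))) :
    t = church n := by
  rcases ht.neutral_or_eq_lam with hn | ⟨u, rfl⟩
  · cases h.eq_var_zero_of_neutral (hn.rename (· + 2))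
  have h₁ := h.of_weakHead (.app _ (.beta _ _))
  rw [subst_up_subst0] at h₁
  rcases ht.of_lam.neutral_or_eq_lam with hn | ⟨v, rfl⟩
  · have hren : scons (.var 1) (fun n => .var (n + 2)) = fun n => .var (n + 1) := by
      funext n
      cases n <;> rfl
    rw [hren] at h₁
    have := h₁.eq_var_zero_of_neutral (hn.rename (· + 1))
    cases u <;> simp [subst] at this
  · have h₂ := h₁.of_weakHead (.beta _ _)
    have hid : scons (.var 0) (scons (.var 1) fun n => .var (n + 2)) = Lam.var := by
      funext n
      rcases n with _ | _ | n <;> rfl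
    rw [subst_up_subst0, hid, subst_var] at h₂
    rw [h₂.eq_churchBody ht.of_lam.of_lam, church]

namespace Fml

/-- Formulas without second-order quantifiers. -/
def QFree : Fml → Prop
  | pvar _ _ _ => True
  | arr A B => A.QFree ∧ B.QFree
  | all1 A => A.QFree
  | all2 _ _ _ _ => False

/-- Formulas whose second-order quantifiers all lie in the quantifier prefix. -/
def Prenex : Fml → Prop
  | pvar _ _ _ => True
  | arr A B => A.QFree ∧ B.QFree
  | all1 A => A.Prenex
  | all2 _ _ _ A => A.Prenex

/-- Formulas whose prefix binds no predicate variable occurring in its scope. -/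
def Vacuous : Fml → Prop
  | pvar _ _ _ => True
  | arr _ _ => True
  | all1 A => A.Vacuous
  | all2 b X _ A => ¬ A.fv2 b X ∧ A.Vacuous

theorem QFree.prenex {A : Fml} (h : A.QFree) : A.Prenex := by
  induction A with
  | pvar => trivial
  | arr => exact h
  | all1 A ih => exact ih h
  | all2 => exact h.elim

theorem QFree.vacuous {A : Fml} (h : A.QFree) : A.Vacuous := by
  induction A with
  | pvar => trivial
  | arr => trivial
  | all1 A ih => exact ih h
  | all2 => exact h.elim

theorem qFree_lift1By (A : Fml) (c m : ℕ) : (A.lift1By c m).QFree ↔ A.QFree := by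
  induction A generalizing c <;> simp_all [lift1By, QFree]

theorem fv2_lift1By (A : Fml) (c m : ℕ) (b : Bool) (X : ℕ) :
    (A.lift1By c m).fv2 b X ↔ A.fv2 b X := by
  induction A generalizing c <;> simp_all [lift1By, fv2]

theorem qFree_subst1 (A : Fml) (σ : ℕ → Tm) : (A.subst1 σ).QFree ↔ A.QFree := by
  induction A generalizing σ <;> simp_all [subst1, QFree]

theorem prenex_subst1 (A : Fml) (σ : ℕ → Tm) : (A.subst1 σ).Prenex ↔ A.Prenex := by
  induction A generalizing σ <;> simp_all [subst1, Prenex, qFree_subst1]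

theorem fv2_subst1 (A : Fml) (σ : ℕ → Tm) (b : Bool) (X : ℕ) :
    (A.subst1 σ).fv2 b X ↔ A.fv2 b X := by
  induction A generalizing σ <;> simp_all [subst1, fv2]

theorem vacuous_subst1 (A : Fml) (σ : ℕ → Tm) : (A.subst1 σ).Vacuous ↔ A.Vacuous := by
  induction A generalizing σ <;> simp_all [subst1, Vacuous, fv2_subst1]

theorem psubst_of_not_fv2 {A : Fml} {b : Bool} {X : ℕ} (h : ¬ A.fv2 b X) (k : ℕ) (G : Fml)
    (d : ℕ) : psubst b X k G d A = A := by
  induction A generalizing d with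
  | pvar b' X' args => exact if_neg h
  | arr A B ihA ihB =>
    simp only [fv2, not_or] at h
    rw [psubst, ihA h.1, ihB h.2]
  | all1 A ih => rw [psubst, ih h]
  | all2 b' X' m A ih =>
    rw [psubst]
    split_ifs with hX
    · rfl
    · rw [ih fun hA => h ⟨hX, hA⟩]

theorem QFree.of_psubst {A : Fml} {b : Bool} {X k : ℕ} {G : Fml} {d : ℕ}
    (h : (psubst b X k G d A).QFree) : A.QFree := by
  induction A generalizing d with
  | pvar => trivial
  | arr A B ihA ihB => exact ⟨ihA h.1, ihB h.2⟩
  | all1 A ih => exact ih h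
  | all2 b' X' m A ih =>
    rw [psubst] at h
    split_ifs at h <;> exact h.elim

theorem Prenex.of_psubst {A : Fml} {b : Bool} {X k : ℕ} {G : Fml} {d : ℕ}
    (h : (psubst b X k G d A).Prenex) : A.Prenex := by
  induction A generalizing d with
  | pvar => trivial
  | arr A B => exact ⟨QFree.of_psubst h.1, QFree.of_psubst h.2⟩
  | all1 A ih => exact ih h
  | all2 b' X' m A ih =>
    rw [psubst] at h
    split_ifs at h
    · exact h
    · exact ih h

end Fml

open Fml

/-- A neutral term gets from a context without second-order quantifiers only types whose
second-order quantifiers are vacuous. -/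
theorem DerA.prenex_of_neutral {E : Set (Tm × Tm)} {Γ : List Fml} {t : Lam} {A : Fml}
    (h : DerA E Γ t A) (ht : t.Neutral) (hΓ : ∀ B ∈ Γ, B.QFree) :
    A.Prenex ∧ A.Vacuous ∧ ∀ b X, A.fv2 b X → ∃ B ∈ Γ, B.fv2 b X := by
  induction h with
  | var Γ n A hA =>
    have hmem := List.mem_of_getElem? hA
    exact ⟨(hΓ A hmem).prenex, (hΓ A hmem).vacuous, fun b X hX => ⟨A, hmem, hX⟩⟩
  | lamI => exact ht.elim
  | appE _ _ ihu _ =>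
    obtain ⟨hp, -, hfv⟩ := ihu ht hΓ
    exact ⟨QFree.prenex hp.2, QFree.vacuous hp.2, fun b X hX => hfv b X (.inr hX)⟩
  | all1I _ ih =>
    obtain ⟨hp, hv, hfv⟩ := ih ht (by simpa [qFree_lift1By] using hΓ)
    exact ⟨hp, hv, fun b X hX => by simpa [fv2_lift1By] using hfv b X hX⟩
  | all1E u _ ih =>
    obtain ⟨hp, hv, hfv⟩ := ih ht hΓ
    exact ⟨(prenex_subst1 _ _).2 hp, (vacuous_subst1 _ _).2 hv,
      fun b X hX => hfv b X (by rwa [substTop, fv2_subst1] at hX)⟩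
  | all2I b X k _ hX ih =>
    obtain ⟨hp, hv, hfv⟩ := ih ht hΓ
    refine ⟨hp, ⟨fun hA => ?_, hv⟩, fun b' X' h' => hfv b' X' h'.2⟩
    obtain ⟨B, hB, hBX⟩ := hfv b X hA
    exact hX B hB hBX
  | all2E G _ ih =>
    obtain ⟨hp, hv, hfv⟩ := ih ht hΓ
    rw [psubst_of_not_fv2 hv.1]
    refine ⟨hp, hv.2, fun b' X' h' => hfv b' X' ⟨?_, h'⟩⟩
    rintro ⟨rfl, rfl⟩
    exact hv.1 h'
  | eqr _ _ ih =>
    obtain ⟨hp, hv, hfv⟩ := ih ht hΓ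
    exact ⟨(prenex_subst1 _ _).2 ((prenex_subst1 _ _).1 hp),
      (vacuous_subst1 _ _).2 ((vacuous_subst1 _ _).1 hv),
      fun b X hX => hfv b X ((fv2_subst1 _ _ b X).2 ((fv2_subst1 _ _ b X).1 hX))⟩

/-- Sets of terms closed under weak head expansion. -/
def SaturatedSet : Type :=
  {S : Set Lam // ∀ t t', WeakHead t t' → t' ∈ S → t ∈ S}

/-- Extend a first-order valuation by a value for the index `0`. -/
def vcons {D : Type} (d : D) (ρ : ℕ → D) : ℕ → D
  | 0 => d
  | n + 1 => ρ n

/-- A set with a constant and a unary function, interpreting the language `{0, s}`. -/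
structure Interp where
  carrier : Type
  zero : carrier
  succ : carrier → carrier

namespace Interp

variable (M : Interp)

/-- The value of a first-order term. -/
def eval (ρ : ℕ → M.carrier) : Tm → M.carrier
  | .var n => ρ n
  | .zero => M.zero
  | .succ t => M.succ (eval ρ t)

/-- Valuations of the predicate variables. -/
abbrev PredVal : Type := Bool × ℕ → List M.carrier → SaturatedSet

/-- The realizability interpretation of formulas. -/
def Realizes (ρ : ℕ → M.carrier) (η : M.PredVal) : Fml → Lam → Prop
  | .pvar b X args, t => t ∈ (η (b, X) (args.map (M.eval ρ))).1
  | .arr A B, t => ∀ u, Realizes ρ η A u → Realizes ρ η B (.app t u)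
  | .all1 A, t => ∀ d, Realizes (vcons d ρ) η A t
  | .all2 b X _ A, t => ∀ R, Realizes ρ (Function.update η (b, X) R) A t

variable {M}

theorem eval_subst (ρ : ℕ → M.carrier) (σ : ℕ → Tm) (t : Tm) :
    M.eval ρ (t.subst σ) = M.eval (fun n => M.eval ρ (σ n)) t := by
  induction t <;> simp_all [eval, Tm.subst]

theorem eval_liftBy (ρ : ℕ → M.carrier) (c m : ℕ) (t : Tm) :
    M.eval ρ (t.liftBy c m) = M.eval (fun n => ρ (if n < c then n else n + m)) t := by
  induction t with
  | var n => simp only [Tm.liftBy]; split_ifs <;> simp [eval, *]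
  | zero => rfl
  | succ t ih => simp [eval, Tm.liftBy, ih]

theorem realizes_subst1 (ρ : ℕ → M.carrier) (η : M.PredVal) (σ : ℕ → Tm) (A : Fml) (t : Lam) :
    M.Realizes ρ η (A.subst1 σ) t ↔ M.Realizes (fun n => M.eval ρ (σ n)) η A t := by
  induction A generalizing ρ η σ t with
  | pvar b X args =>
    have : M.eval ρ ∘ Tm.subst σ = M.eval fun n => M.eval ρ (σ n) := funext (eval_subst ρ σ)
    simp [subst1, Realizes, this]
  | arr A B ihA ihB => simp [subst1, Realizes, ihA, ihB]
  | all1 A ih =>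
    have (d : M.carrier) : (fun n => M.eval (vcons d ρ) (Tm.up σ n))
        = vcons d fun n => M.eval ρ (σ n) := by
      funext n
      cases n with
      | zero => rfl
      | succ n => simp [Tm.up, eval_liftBy, vcons]
    simp [subst1, Realizes, ih, this]
  | all2 b X k A ih => simp [subst1, Realizes, ih]

theorem realizes_substTop (ρ : ℕ → M.carrier) (η : M.PredVal) (u : Tm) (A : Fml) (t : Lam) :
    M.Realizes ρ η (A.substTop u) t ↔ M.Realizes (vcons (M.eval ρ u) ρ) η A t := by
  have : (fun n => M.eval ρ (match n with | 0 => u | n + 1 => Tm.var n))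
      = vcons (M.eval ρ u) ρ := by
    funext n
    cases n <;> rfl
  rw [substTop, realizes_subst1, ← this]

theorem realizes_lift1By (ρ : ℕ → M.carrier) (η : M.PredVal) (c m : ℕ) (A : Fml) (t : Lam) :
    M.Realizes ρ η (A.lift1By c m) t ↔
      M.Realizes (fun n => ρ (if n < c then n else n + m)) η A t := by
  induction A generalizing ρ η c t with
  | pvar b X args =>
    have : M.eval ρ ∘ Tm.liftBy c m = M.eval fun n => ρ (if n < c then n else n + m) :=
      funext (eval_liftBy ρ c m)
    simp [lift1By, Realizes, this]
  | arr A B ihA ihB => simp [lift1By, Realizes, ihA, ihB]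
  | all1 A ih =>
    have (d : M.carrier) : (fun n => vcons d ρ (if n < c + 1 then n else n + m))
        = vcons d fun n => ρ (if n < c then n else n + m) := by
      funext n
      cases n with
      | zero => rfl
      | succ n => by_cases h : n < c <;> simp [vcons, h, Nat.add_right_comm n 1 m]
    simp only [lift1By, Realizes, ih, this]
  | all2 b X k A ih => simp [lift1By, Realizes, ih]

theorem realizes_update_of_not_fv2 (ρ : ℕ → M.carrier) (η : M.PredVal) {b : Bool} {X : ℕ}
    (R : List M.carrier → SaturatedSet) {A : Fml} (h : ¬ A.fv2 b X) (t : Lam) :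
    M.Realizes ρ (Function.update η (b, X) R) A t ↔ M.Realizes ρ η A t := by
  induction A generalizing ρ η t with
  | pvar b' X' args =>
    have : (b', X') ≠ (b, X) := fun h' => h (by simp_all [fv2])
    simp [Realizes, Function.update_of_ne this]
  | arr A B ihA ihB =>
    simp only [fv2, not_or] at h
    simp [Realizes, ihA _ _ h.1, ihB _ _ h.2]
  | all1 A ih => simp [Realizes, ih _ _ h]
  | all2 b' X' k A ih =>
    simp only [Realizes]
    by_cases hX : (b, X) = (b', X')
    · rw [hX]
      simp [Function.update_idem]
    · simp only [Function.update_comm hX]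
      refine forall_congr' fun S => ih _ _ (fun hA => h ⟨?_, hA⟩) _
      simpa using hX

theorem Realizes.expand {ρ : ℕ → M.carrier} {η : M.PredVal} {A : Fml} {t t' : Lam}
    (h : M.Realizes ρ η A t') (hw : WeakHead t t') : M.Realizes ρ η A t := by
  induction A generalizing ρ η t t' with
  | pvar b X args => exact (η (b, X) _).2 _ _ hw h
  | arr A B _ ihB => exact fun u hu => ihB (h u hu) (.app u hw)
  | all1 A ih => exact fun d => ih (h d) hw
  | all2 b X k A ih => exact fun R => ih (h R) hw

/-- The predicate defined by a formula with argument slots `0, …, k - 1`. -/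
def pred (ρ : ℕ → M.carrier) (η : M.PredVal) (k : ℕ) (G : Fml) (l : List M.carrier) :
    SaturatedSet :=
  ⟨{t | M.Realizes (fun n => if n < k then l.getD n M.zero else ρ (n - k)) η G t},
    fun _ _ hw h => Realizes.expand h hw⟩

theorem realizes_psubst_of_qFree {ρ ρ' : ℕ → M.carrier} (η : M.PredVal) (b : Bool) (X k : ℕ)
    (G : Fml) {d : ℕ} (hρ : ∀ n, ρ' (n + d) = ρ n) {A : Fml} (hA : A.QFree) (t : Lam) :
    M.Realizes ρ' η (psubst b X k G d A) t ↔
      M.Realizes ρ' (Function.update η (b, X) (pred ρ η k G)) A t := by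
  induction A generalizing ρ' d t with
  | pvar b' X' args =>
    rw [psubst]
    split_ifs with h
    · obtain ⟨rfl, rfl⟩ := h
      rw [instArgs, realizes_subst1, realizes_lift1By]
      simp only [Realizes, Function.update_self, pred, Set.mem_ofPred_eq]
      refine iff_of_eq (congrArg (fun r => M.Realizes r η G t) (funext fun n => ?_))
      by_cases hn : n < k
      · simp only [hn, if_true]
        rw [show M.zero = M.eval ρ' Tm.zero from rfl, List.getD_map]
      · have : ¬ n + d < k := by omega
        simp only [hn, this, if_false, eval]
        rw [← hρ]
        congr 1
        omega
    · have : (b', X') ≠ (b, X) := fun h' => h (by simp_all)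
      simp [Realizes, Function.update_of_ne this]
  | arr A B ihA ihB => simp [psubst, Realizes, ihA hρ hA.1, ihB hρ hA.2]
  | all1 A ih =>
    simp only [psubst, Realizes]
    exact forall_congr' fun e => ih (ρ' := vcons e ρ') (d := d + 1) (fun n => hρ n) hA t
  | all2 => exact hA.elim

/-- Instantiation is sound on prenex formulas, even though `Fml.psubst` may capture
predicate variables of `G`. -/
theorem realizes_psubst_of_prenex {ρ ρ' : ℕ → M.carrier} {η : M.PredVal} {b : Bool} {X k : ℕ}
    {G : Fml} {d : ℕ} (hρ : ∀ n, ρ' (n + d) = ρ n) {A : Fml} (hA : A.Prenex) {t : Lam}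
    (h : ∀ R, M.Realizes ρ' (Function.update η (b, X) R) A t) :
    M.Realizes ρ' η (psubst b X k G d A) t := by
  induction A generalizing ρ' η d t with
  | pvar => exact (realizes_psubst_of_qFree η b X k G hρ (A := .pvar ..) trivial t).2 (h _)
  | arr A B => exact (realizes_psubst_of_qFree η b X k G hρ (A := .arr A B) hA t).2 (h _)
  | all1 A ih => exact fun e => ih (ρ' := vcons e ρ') (d := d + 1) (fun n => hρ n) hA fun R => h R e
  | all2 b' X' m A ih =>
    rw [psubst]
    split_ifs with hX
    · obtain ⟨rfl, rfl⟩ := hX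
      intro S
      simpa [Function.update_idem] using h (η (b, X)) S
    · intro S
      have hX' : (b, X) ≠ (b', X') := fun h' => hX (by simpa using h')
      refine ih hρ hA fun R => ?_
      rw [Function.update_comm hX'.symm]
      exact h R S

/-- Typable normal terms realize their type. -/
theorem realizes_of_derA {E : Set (Tm × Tm)}
    (hE : ∀ u v, EqCns E u v → ∀ ρ, M.eval ρ u = M.eval ρ v)
    {Γ : List Fml} {t : Lam} {A : Fml} (h : DerA E Γ t A) (ht : NormalForm t)
    (hΓ : ∀ B ∈ Γ, B.QFree) (hA : A.Prenex) (ρ : ℕ → M.carrier) (η : M.PredVal) (σ : ℕ → Lam)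
    (hσ : ∀ i B, Γ[i]? = some B → M.Realizes ρ η B (σ i)) :
    M.Realizes ρ η A (t.subst σ) := by
  induction h generalizing ρ η σ with
  | var Γ n A hn => exact hσ n A hn
  | lamI _ ih =>
    intro a ha
    refine Realizes.expand ?_ (.beta _ _)
    rw [subst_up_subst0]
    refine ih ht.of_lam (by simpa using ⟨hA.1, hΓ⟩) hA.2.prenex ρ η _ fun i B hi => ?_
    cases i with
    | zero => cases hi; exact ha
    | succ i => exact hσ i B hi
  | appE hu _ ihu ihv =>
    have hp := (hu.prenex_of_neutral ht.neutral_of_app hΓ).1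
    exact ihu ht.appL hΓ hp ρ η σ hσ _ (ihv ht.appR hΓ hp.1.prenex ρ η σ hσ)
  | all1I _ ih =>
    intro d
    refine ih ht (by simpa [qFree_lift1By] using hΓ) hA _ η σ fun i B hi => ?_
    rw [List.getElem?_map, Option.map_eq_some_iff] at hi
    obtain ⟨C, hC, rfl⟩ := hi
    exact (realizes_lift1By _ η 0 1 C _).2 (hσ i C hC)
  | all1E u _ ih =>
    exact (realizes_substTop ρ η u _ _).2
      (ih ht hΓ (by rwa [substTop, prenex_subst1] at hA) ρ η σ hσ (M.eval ρ u))
  | all2I b X k _ hX ih =>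
    intro R
    exact ih ht hΓ hA ρ _ σ fun i B hi =>
      (realizes_update_of_not_fv2 ρ η R (hX B (List.mem_of_getElem? hi)) _).2 (hσ i B hi)
  | all2E G _ ih =>
    have hA' := Prenex.of_psubst hA
    exact realizes_psubst_of_prenex (fun _ => rfl) hA' (ih ht hΓ hA' ρ η σ hσ)
  | eqr _ huv ih =>
    rw [realizes_substTop, ← hE _ _ huv ρ, ← realizes_substTop]
    exact ih ht hΓ ((prenex_subst1 _ _).2 ((prenex_subst1 _ _).1 hA)) ρ η σ hσ

theorem eval_snum_injective (hs : Function.Injective M.succ) (hz : ∀ a, M.succ a ≠ M.zero)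
    (ρ : ℕ → M.carrier) : Function.Injective fun n => M.eval ρ (snum n) := by
  intro m n h
  induction m generalizing n with
  | zero =>
    cases n with
    | zero => rfl
    | succ n => exact (hz _ h.symm).elim
  | succ m ih =>
    cases n with
    | zero => exact (hz _ h).elim
    | succ n => exact congrArg _ (ih (hs h))

end Interp

/-- Equational consequence as a setoid. -/
def EqCns.setoid (E : Set (Tm × Tm)) : Setoid Tm :=
  ⟨EqCns E, .refl, .symm, .trans⟩

/-- The term model of a set of equations. -/
def termInterp (E : Set (Tm × Tm)) : Interp where
  carrier := Quotient (EqCns.setoid E)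
  zero := Quotient.mk _ .zero
  succ := Quotient.map Tm.succ fun _ _ => EqCns.succ

theorem termInterp_eval_mk (E : Set (Tm × Tm)) (σ : ℕ → Tm) (t : Tm) :
    (termInterp E).eval (fun n => Quotient.mk (EqCns.setoid E) (σ n)) t
      = Quotient.mk (EqCns.setoid E) (t.subst σ) := by
  induction t with
  | var n => rfl
  | zero => rfl
  | succ t ih => exact congrArg (termInterp E).succ ih

theorem termInterp_eval_eq {E : Set (Tm × Tm)} {u v : Tm} (h : EqCns E u v)
    (ρ : ℕ → (termInterp E).carrier) : (termInterp E).eval ρ u = (termInterp E).eval ρ v := by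
  induction h with
  | @ax u v σ huv =>
    rw [Interp.eval_subst, Interp.eval_subst]
    obtain ⟨τ, hτ⟩ : ∃ τ : ℕ → Tm, (fun n => (termInterp E).eval ρ (σ n))
        = fun n => Quotient.mk (EqCns.setoid E) (τ n) :=
      ⟨fun n => Quotient.out ((termInterp E).eval ρ (σ n)),
        funext fun n => (Quotient.out_eq _).symm⟩
    rw [hτ, termInterp_eval_mk, termInterp_eval_mk]
    exact Quotient.sound (EqCns.ax τ huv)
  | refl => rfl
  | symm _ ih => exact ih.symm
  | trans _ _ ih₁ ih₂ => exact ih₁.trans ih₂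
  | succ _ ih => exact congrArg (termInterp E).succ ih

theorem Adequate.termInterp_succ_injective {E : Set (Tm × Tm)} (hE : Adequate E) :
    Function.Injective (termInterp E).succ := by
  intro a b
  induction a using Quotient.inductionOn
  induction b using Quotient.inductionOn
  exact fun h => Quotient.sound (hE.2 _ _ (Quotient.exact h))

theorem Adequate.termInterp_succ_ne_zero {E : Set (Tm × Tm)} (hE : Adequate E)
    (a : (termInterp E).carrier) : (termInterp E).succ a ≠ (termInterp E).zero := by
  induction a using Quotient.inductionOn
  exact fun h => hE.1 _ (Quotient.exact h)

theorem DerA.churchBody (E : Set (Tm × Tm)) (n : ℕ) :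
    DerA E [.all1 (.arr (.pvar false 0 [Tm.var 0]) (.pvar false 0 [Tm.succ (Tm.var 0)])),
      .pvar false 0 [Tm.zero]] (churchBody n) (.pvar false 0 [snum n]) := by
  induction n with
  | zero => exact .var _ 1 _ rfl
  | succ n ih =>
    refine .appE (A := .pvar false 0 [snum n]) ?_ ih
    exact .all1E (A := .arr (.pvar false 0 [Tm.var 0]) (.pvar false 0 [Tm.succ (Tm.var 0)]))
      (snum n) (.var _ 0 _ rfl)

/-- The predicate sending the value of `sⁿ(0)` to the terms evaluating to `churchBody n`. -/
def numeralPred (M : Interp) (ρ : ℕ → M.carrier) (l : List M.carrier) : SaturatedSet :=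
  ⟨{t | ∃ m, l = [M.eval ρ (snum m)] ∧ Evaluates m t},
    fun _ _ hw ⟨m, hl, h⟩ => ⟨m, hl, .expand hw h⟩⟩

theorem evaluates_of_realizes_nty {M : Interp} (hs : Function.Injective M.succ)
    (hz : ∀ a, M.succ a ≠ M.zero) {ρ : ℕ → M.carrier} {η : M.PredVal} {n : ℕ} {t : Lam}
    (h : M.Realizes ρ η (Nty (snum n)) t) :
    Evaluates n (.app (.app t (.var 1)) (.var 0)) := by
  have h' := h (numeralPred M ρ) (.var 1) (by
    simp only [Interp.Realizes, Function.update_self]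
    exact ⟨0, rfl, .zero⟩) (.var 0) (by
    intro d u hu
    simp only [Interp.Realizes, Function.update_self] at hu ⊢
    obtain ⟨m, hm, hu⟩ := hu
    refine ⟨m + 1, ?_, .succ hu⟩
    have hd : d = M.eval ρ (snum m) := by simpa [Interp.eval, vcons] using hm
    simp [Interp.eval, snum, vcons, hd])
  simp only [Interp.Realizes, Function.update_self] at h'
  obtain ⟨m, hm, h'⟩ := h'
  have : n = m := Interp.eval_snum_injective hs hz ρ (by simpa using hm)
  exact this ▸ h'

/-- For each `n`, the Church numeral `n̲` is the unique normal λ-term of type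
`N[sⁿ(0)]` in AF2 (over an adequate set of equations). -/
theorem church_unique_normal_of_type (E : Set (Tm × Tm)) (hE : Adequate E) (n : ℕ) :
    DerA E [] (church n) (Nty (snum n)) ∧
      ∀ t : Lam, NormalForm t → DerA E [] t (Nty (snum n)) → t = church n := by
  refine ⟨.all2I _ _ _ (.lamI (.lamI (.churchBody E n))) (by simp), fun t ht h => ?_⟩
  have hr := Interp.realizes_of_derA (M := termInterp E) (fun _ _ => termInterp_eval_eq) h ht
    (by simp) (by simp [Nty, NtyGen, Prenex, QFree]) (fun _ => (termInterp E).zero)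
    (fun _ _ => ⟨Set.univ, by simp⟩) (fun n => .var (n + 2)) (by simp)
  exact ht.eq_church
    (evaluates_of_realizes_nty hE.termInterp_succ_injective hE.termInterp_succ_ne_zero hr)
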